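/- Let q ∈ (2,4) and a, b, λ, μ, σ₁ > 0. Suppose X ≥ 0, Y ≥ 0, W ≥ 0 are real numbers satisfying σ₁·Y ≤ X and a·X + b·X² ≤ λ·Y^((4−q)/2)·W^((q−2)/2) + μ·W. Then b·X² − μ·W ≤ (λ^(2/(q−2)) / (μ·(aσ₁)^((4−q)/(q−2)) + λ^(2/(q−2))))·b·X². -/

import Mathlib

open Real

/-- For `q ∈ (2,4)`, `a, b, λ, μ, σ₁ > 0`, and nonnegative reals
`X, Y, W` with `σ₁·Y ≤ X` and `a·X + b·X² ≤ λ·Y^((4−q)/2)·W^((q−2)/2) + μ·W`, one has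
`b·X² − μ·W ≤ (λ^(2/(q−2)) / (μ·(aσ₁)^((4−q)/(q−2)) + λ^(2/(q−2))))·b·X²`. -/
theorem stmt_14 (q a b lam μ σ₁ X Y W : ℝ) (hq2 : 2 < q) (hq4 : q < 4)
    (ha : 0 < a) (hb : 0 < b) (hlam : 0 < lam) (hμ : 0 < μ) (hσ : 0 < σ₁)
    (hX : 0 ≤ X) (hY : 0 ≤ Y) (hW : 0 ≤ W)
    (h1 : σ₁ * Y ≤ X)
    (h2 : a * X + b * X ^ 2 ≤ lam * Y ^ ((4 - q) / 2) * W ^ ((q - 2) / 2) + μ * W) :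
    b * X ^ 2 - μ * W ≤
      lam ^ ((2 : ℝ) / (q - 2)) /
          (μ * (a * σ₁) ^ ((4 - q) / (q - 2)) + lam ^ ((2 : ℝ) / (q - 2))) *
        (b * X ^ 2) := by
  have ht : 0 < q - 2 := by linarith
  have hs : 0 < a * σ₁ := by positivity
  set L := lam ^ ((2 : ℝ) / (q - 2)) with hL
  set S := (a * σ₁) ^ ((4 - q) / (q - 2)) with hS
  have hLp : 0 < L := by positivity
  have hSp : 0 < S := by positivity
  have hLt : L ^ ((q - 2) / 2) = lam := by
    rw [hL, ← Real.rpow_mul hlam.le]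
    have : (2 : ℝ) / (q - 2) * ((q - 2) / 2) = 1 := by field_simp
    rw [this, Real.rpow_one]
  have hSt : S ^ ((q - 2) / 2) = (a * σ₁) ^ ((4 - q) / 2) := by
    rw [hS, ← Real.rpow_mul hs.le]
    congr 1
    field_simp
  have hLWS : 0 ≤ L * W / S := by positivity
  have hsY : 0 ≤ a * σ₁ * Y := by positivity
  have young := Real.geom_mean_le_arith_mean2_weighted
    (w₁ := (4 - q) / 2) (w₂ := (q - 2) / 2) (p₁ := a * σ₁ * Y) (p₂ := L * W / S)
    (by linarith) (by linarith) hsY hLWS (by ring)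
  have hpow : (a * σ₁ * Y) ^ ((4 - q) / 2) * (L * W / S) ^ ((q - 2) / 2)
      = lam * Y ^ ((4 - q) / 2) * W ^ ((q - 2) / 2) := by
    rw [Real.mul_rpow hs.le hY, Real.div_rpow (by positivity) hSp.le,
      Real.mul_rpow hLp.le hW, hLt, hSt]
    have : 0 < (a * σ₁) ^ ((4 - q) / 2) := by positivity
    field_simp
  rw [hpow] at young
  have h3 : a * σ₁ * Y ≤ a * X := by
    rw [mul_assoc]; exact mul_le_mul_of_nonneg_left h1 ha.le
  have h4 : b * X ^ 2 - μ * W ≤ L * W / S := by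
    have e1 : (4 - q) / 2 * (a * σ₁ * Y) ≤ a * σ₁ * Y :=
      mul_le_of_le_one_left hsY (by linarith)
    have e2 : (q - 2) / 2 * (L * W / S) ≤ L * W / S :=
      mul_le_of_le_one_left hLWS (by linarith)
    linarith
  rw [le_div_iff₀ hSp] at h4
  rw [div_mul_eq_mul_div, le_div_iff₀ (by positivity)]
  have h5 := mul_le_mul_of_nonneg_left h4 hμ.le
  linarith [h5]
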